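/- arXiv:1810.08546 — 2 statements merged into one kernel-verified Lean document; each statement's English description precedes it below -/
import Mathlib

section
/- Let k be a field, M a finite-dimensional k-vector space, and G ⊂ GL(M) a closed reductive subgroup. If two cocharacters μ, μ' : G_m → G induce the same filtration on M, then μ and μ' are conjugate by an element of G(k). -/
/-!
STATEMENT 3: Let `k` be a field, `M` a finite-dimensional `k`-vector space, and
`G ⊆ GL(M)` a closed reductive subgroup.  If two cocharacters `μ, μ' : 𝔾_m → G` induce
the same filtration on `M`, then they are conjugate by an element of `G(k)`.

Model: `M = kⁿ`, `G` a subgroup of `GL_n(k)` that is Zariski-closed (cut out by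
polynomials in the matrix entries) and reductive (here: no nontrivial normal unipotent
subgroup).  A cocharacter is a homomorphism `μ : kˣ →* GL_n(k)` with values in `G`
together with a grading `M = ⊕ᵢ Mᵢ` on which `μ(z)` acts by `zⁱ`; it induces the
descending filtration `Fil^j M = ⊕_{i ≥ j} Mᵢ`.
-/

open Matrix

/-- Conjugacy part of the Schur–Zassenhaus theorem, for a cyclic complement. -/
theorem exists_conj_eq_of_coprime {K : Type*} [Group K] (H : Subgroup K) [Finite H] {m : ℕ}
    (hm : m.Coprime (Nat.card H)) {s t : K} (hs : s ^ m = 1) (ht : t ^ m = 1)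
    (hnorm : ∀ h ∈ H, s⁻¹ * h * s ∈ H) (hst : s⁻¹ * t ∈ H) :
    ∃ h ∈ H, t = h * s * h⁻¹ := by
  obtain ⟨e, he₁, he₀⟩ := Nat.chineseRemainder hm 1 0
  have pow_e {x : K} (hx : x ^ m = 1) : x ^ e = x := by
    simpa using pow_eq_pow_iff_modEq.2 (he₁.of_dvd (orderOf_dvd_of_pow_eq_one hx))
  have pow_e' (c : K) (hc : c ∈ H) : c ^ e = 1 := by
    obtain ⟨q, rfl⟩ := (Nat.modEq_zero_iff_dvd).1 he₀
    rw [pow_mul, show c ^ Nat.card H = 1 from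
      congrArg Subtype.val (pow_card_eq_one' (x := (⟨c, hc⟩ : H))), one_pow]
  let C : Subgroup H := (Subgroup.centralizer {s}).subgroupOf H
  have hC (c : C) : Commute s (c : H) :=
    (Subgroup.mem_centralizer_singleton_iff.1 (Subgroup.mem_subgroupOf.1 c.2)).symm
  let Φ : (H ⧸ C) × C → H := fun x ↦
    ⟨s⁻¹ * (x.1.out : K) * s * (x.2 : H) * (x.1.out : K)⁻¹,
      H.mul_mem (H.mul_mem (hnorm _ x.1.out.2) (x.2 : H).2) (H.inv_mem x.1.out.2)⟩
  have key (a : K) (c : C) : (a * (s * (c : H)) * a⁻¹) ^ e = a * s * a⁻¹ := by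
    rw [conj_pow, (hC c).mul_pow, pow_e hs, pow_e' _ (c : H).2, mul_one]
  have hΦ (x) : s * (Φ x : K) = (x.1.out : K) * (s * (x.2 : H)) * (x.1.out : K)⁻¹ := by
    simp only [Φ]; group
  have hinj : Function.Injective Φ := by
    rintro ⟨a, c⟩ ⟨b, d⟩ h
    have h₁ : (a.out : K) * (s * (c : H)) * (a.out : K)⁻¹
        = (b.out : K) * (s * (d : H)) * (b.out : K)⁻¹ := by
      rw [← hΦ (a, c), ← hΦ (b, d), h]
    have h₂ : (a.out : K) * s * (a.out : K)⁻¹ = (b.out : K) * s * (b.out : K)⁻¹ := by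
      rw [← key _ c, ← key _ d, h₁]
    have hab : a = b := by
      rw [← a.out_eq', ← b.out_eq', QuotientGroup.eq]
      refine Subgroup.mem_subgroupOf.2 (Subgroup.mem_centralizer_singleton_iff.2 ?_)
      have h₃ := congrArg (fun x ↦ (a.out : K)⁻¹ * x * (b.out : K)) h₂
      simpa [mul_assoc] using h₃.symm
    subst hab
    simpa using h₁
  have hsurj : Function.Surjective Φ :=
    (hinj.bijective_of_nat_card_le
      (Nat.card_congr C.groupEquivQuotientProdSubgroup).le).2
  obtain ⟨⟨a, c⟩, hac⟩ := hsurj ⟨_, hst⟩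
  refine ⟨a.out, a.out.2, ?_⟩
  have h := hΦ (a, c)
  rw [hac, mul_inv_cancel_left] at h
  dsimp only at h
  rw [← key _ c, ← h, pow_e ht]

section Filtration

variable {k V : Type*} [Field k] [AddCommGroup V] [Module k V]

/-- The descending filtration `Fil^j = ⨆ i ≥ j, W i` attached to a family of subspaces. -/
def weightFil (W : ℤ → Submodule k V) (j : ℤ) : Submodule k V :=
  ⨆ i ∈ {i : ℤ | j ≤ i}, W i

theorem weight_le_weightFil (W : ℤ → Submodule k V) {i j : ℤ} (h : j ≤ i) :
    W i ≤ weightFil W j :=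
  le_iSup₂_of_le i h le_rfl

theorem weightFil_antitone (W : ℤ → Submodule k V) : Antitone (weightFil W) :=
  fun _ _ h ↦ iSup₂_le fun _ hi ↦ weight_le_weightFil W (h.trans hi)

theorem iSupIndep_of_inf_eq_bot {W : ℤ → Submodule k V}
    (h : ∀ i, W i ⊓ (⨆ j ∈ {j : ℤ | j ≠ i}, W j) = ⊥) : iSupIndep W :=
  fun i ↦ disjoint_iff.2 (h i)

theorem mem_of_mem_weightFil {W : ℤ → Submodule k V} {j : ℤ} {S : Submodule k V}
    (h : ∀ i, j ≤ i → W i ≤ S) {m : V} (hm : m ∈ weightFil W j) : m ∈ S :=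
  (iSup₂_le h : weightFil W j ≤ S) hm

/-- An operator of weight `i` on each `W i` acts on `Fil^j / Fil^(j+1)` as the scalar `c ^ j`. -/
theorem sub_smul_mem_weightFil {W : ℤ → Submodule k V} {L : V →ₗ[k] V} {c : k}
    (hL : ∀ i, ∀ m ∈ W i, L m = c ^ i • m) {j : ℤ} {m : V} (hm : m ∈ weightFil W j) :
    L m - c ^ j • m ∈ weightFil W (j + 1) := by
  refine mem_of_mem_weightFil (S := (weightFil W (j + 1)).comap (L - c ^ j • LinearMap.id))
    (fun i hi m hm ↦ ?_) hm
  simp only [Submodule.mem_comap, LinearMap.sub_apply, LinearMap.smul_apply, LinearMap.id_apply,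
    hL i m hm]
  rcases hi.eq_or_lt with rfl | hlt
  · simp
  · have := weight_le_weightFil W (Int.add_one_le_of_lt hlt) hm
    exact sub_mem (Submodule.smul_mem _ _ this) (Submodule.smul_mem _ _ this)

theorem apply_mem_weightFil {W : ℤ → Submodule k V} {L : V →ₗ[k] V} {c : k}
    (hL : ∀ i, ∀ m ∈ W i, L m = c ^ i • m) {j : ℤ} {m : V} (hm : m ∈ weightFil W j) :
    L m ∈ weightFil W j := by
  have := weightFil_antitone W (Int.le_add_one le_rfl) (sub_smul_mem_weightFil hL hm)
  simpa using add_mem this (Submodule.smul_mem _ (c ^ j) hm)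

theorem exists_weightFil_eq_top_eq_bot [FiniteDimensional k V] {W : ℤ → Submodule k V}
    (hind : iSupIndep W) (htop : ⨆ i, W i = ⊤) :
    ∃ a : ℤ, ∃ N : ℕ, weightFil W a = ⊤ ∧ weightFil W (a + N) = ⊥ := by
  have hfin : {i | W i ≠ ⊥}.Finite := WellFoundedGT.finite_ne_bot_of_iSupIndep hind
  obtain ⟨a, ha⟩ := hfin.bddBelow
  obtain ⟨b, hb⟩ := hfin.bddAbove
  refine ⟨a, (b + 1 - a).toNat, top_unique (htop ▸ iSup_le fun i ↦ ?_),
    bot_unique (iSup₂_le fun i hi ↦ ?_)⟩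
  · by_cases h : W i = ⊥
    · simp [h]
    · exact weight_le_weightFil W (ha h)
  · by_contra h
    have := hb (show W i ≠ ⊥ from fun h' ↦ h (h' ▸ le_rfl))
    simp only [Set.mem_ofPred_eq] at hi
    omega

/-- An operator which raises an exhaustive separated filtration is nilpotent. -/
theorem isNilpotent_of_mapsTo_weightFil [FiniteDimensional k V] {W : ℤ → Submodule k V}
    (hind : iSupIndep W) (htop : ⨆ i, W i = ⊤) {L : V →ₗ[k] V}
    (hL : ∀ j, ∀ m ∈ weightFil W j, L m ∈ weightFil W (j + 1)) : IsNilpotent L := by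
  obtain ⟨a, N, ha, hN⟩ := exists_weightFil_eq_top_eq_bot hind htop
  have h (t : ℕ) (m : V) : (L ^ t) m ∈ weightFil W (a + t) := by
    induction t with
    | zero => simp [ha]
    | succ t ih =>
      rw [pow_succ', Nat.cast_succ, ← add_assoc]
      exact hL _ _ ih
  exact ⟨N, LinearMap.ext fun m ↦ by simpa [hN] using h N m⟩

/-- The projections onto the summands of a grading. -/
theorem exists_weight_projections [FiniteDimensional k V] {W : ℤ → Submodule k V}
    (hind : iSupIndep W) (htop : ⨆ i, W i = ⊤) :
    ∃ (s : Finset ℤ) (π : ℤ → V →ₗ[k] V), (∀ i m, π i m ∈ W i) ∧ (∀ i, ∀ m ∈ W i, π i m = m) ∧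
      (∀ i j, i ≠ j → ∀ m ∈ W j, π i m = 0) ∧ (∀ t, s ⊆ t → ∑ i ∈ t, π i = LinearMap.id) := by
  classical
  have hfin : {i | W i ≠ ⊥}.Finite := WellFoundedGT.finite_ne_bot_of_iSupIndep hind
  let := (DirectSum.isInternal_submodule_of_iSupIndep_of_iSup_eq_top hind
    htop).chooseDecomposition
  let π (i : ℤ) : V →ₗ[k] V := (W i).subtype ∘ₗ DirectSum.component k ℤ (fun i ↦ W i) i ∘ₗ
    (DirectSum.decomposeLinearEquiv W).toLinearMap
  have same : ∀ i, ∀ m ∈ W i, π i m = m := fun i m hm ↦ DirectSum.decompose_of_mem_same W hm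
  have ne : ∀ i j, i ≠ j → ∀ m ∈ W j, π i m = 0 :=
    fun i j hij m hm ↦ DirectSum.decompose_of_mem_ne W hm hij.symm
  refine ⟨hfin.toFinset, π, fun i m ↦ Submodule.coe_mem _, same, ne, fun t ht ↦ ?_⟩
  refine LinearMap.ext fun m ↦ ?_
  have hm : m ∈ ⨆ i, W i := htop ▸ Submodule.mem_top
  refine (iSup_le fun j m hm ↦ ?_ :
    ⨆ i, W i ≤ LinearMap.eqLocus (∑ i ∈ t, π i) LinearMap.id) hm
  simp only [LinearMap.mem_eqLocus, LinearMap.sum_apply, LinearMap.id_apply]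
  by_cases hj : j ∈ t
  · rw [Finset.sum_eq_single_of_mem j hj fun i _ hij ↦ ne i j hij m hm, same j m hm]
  · have : W j = ⊥ := by
      by_contra h
      exact hj (ht (hfin.mem_toFinset.2 h))
    rw [this, Submodule.mem_bot] at hm
    simp [hm]

end Filtration

theorem MvPolynomial.eval_curve_zero_of_forall_ne {k σ : Type*} [Field k] [Infinite k]
    (F : σ → Polynomial k) (P : MvPolynomial σ k)
    (h : ∀ z : k, z ≠ 0 → MvPolynomial.eval (fun x ↦ (F x).eval z) P = 0) :
    MvPolynomial.eval (fun x ↦ (F x).eval 0) P = 0 := by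
  have hQ (z : k) : (MvPolynomial.aeval F P).eval z =
      MvPolynomial.eval (fun x ↦ (F x).eval z) P := by
    have := MvPolynomial.comp_aeval_apply F (Polynomial.aeval z) P
    simpa [Polynomial.coe_aeval_eq_eval, MvPolynomial.aeval_eq_eval] using this
  have h0 : MvPolynomial.aeval F P = 0 :=
    Polynomial.eq_zero_of_infinite_isRoot _ <| (Set.finite_singleton (0 : k)).infinite_compl.mono
      fun z hz ↦ (hQ z).trans (h z hz)
  rw [← hQ, h0, Polynomial.eval_zero]

section Projections

variable {k V : Type*} [Field k] [AddCommGroup V] [Module k V]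
  {W W' : ℤ → Submodule k V} {π π' : ℤ → V →ₗ[k] V}

theorem projection_eq_zero_of_mem_weightFil (hne : ∀ i j, i ≠ j → ∀ m ∈ W j, π i m = 0) {i j : ℤ}
    (hij : i < j) {m : V} (hm : m ∈ weightFil W j) : π i m = 0 :=
  mem_of_mem_weightFil (S := LinearMap.ker (π i))
    (fun l hl _ hx ↦ hne i l (hij.trans_le hl).ne _ hx) hm

theorem sub_projection_mem_weightFil (hsame : ∀ i, ∀ m ∈ W i, π i m = m)
    (hne : ∀ i j, i ≠ j → ∀ m ∈ W j, π i m = 0) {i : ℤ} {m : V} (hm : m ∈ weightFil W i) :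
    m - π i m ∈ weightFil W (i + 1) := by
  refine mem_of_mem_weightFil (S := (weightFil W (i + 1)).comap (LinearMap.id - π i))
    (fun l hl m hm ↦ ?_) hm
  simp only [Submodule.mem_comap, LinearMap.sub_apply, LinearMap.id_apply]
  rcases hl.eq_or_lt with rfl | hlt
  · simp [hsame _ m hm]
  · rw [hne i l hlt.ne m hm, sub_zero]
    exact weight_le_weightFil W (Int.add_one_le_of_lt hlt) hm

/-- The operator matching two gradings with the same filtration is injective. -/
theorem injective_sum_projection_comp (hfil : ∀ j, weightFil W j = weightFil W' j) {t : Finset ℤ}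
    (hmem : ∀ i m, π i m ∈ W i) (hsame : ∀ i, ∀ m ∈ W i, π i m = m)
    (hne : ∀ i j, i ≠ j → ∀ m ∈ W j, π i m = 0) (hsum : ∑ i ∈ t, π i = LinearMap.id)
    (hmem' : ∀ i m, π' i m ∈ W' i) (hsame' : ∀ i, ∀ m ∈ W' i, π' i m = m)
    (hne' : ∀ i j, i ≠ j → ∀ m ∈ W' j, π' i m = 0) :
    Function.Injective (∑ i ∈ t, π' i ∘ₗ π i : V →ₗ[k] V) := by
  refine (injective_iff_map_eq_zero _).2 fun m hm ↦ ?_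
  have h (i : ℤ) (hi : i ∈ t) : π i m = 0 := by
    have h₁ : π' i (π i m) = 0 := by
      have := congrArg (π' i) hm
      rw [LinearMap.sum_apply, map_sum, Finset.sum_eq_single_of_mem i hi
        fun j _ hji ↦ hne' i j hji.symm ((π' j ∘ₗ π j) m) (hmem' j _), LinearMap.comp_apply,
        hsame' i _ (hmem' i _), map_zero] at this
      exact this
    have h₂ := sub_projection_mem_weightFil hsame' hne'
      (hfil i ▸ weight_le_weightFil W le_rfl (hmem i m))
    rw [h₁, sub_zero, ← hfil] at h₂
    rw [← hsame i _ (hmem i m)]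
    exact projection_eq_zero_of_mem_weightFil hne (Int.lt_succ i) h₂
  rw [← LinearMap.id_apply (R := k) m, ← hsum, LinearMap.sum_apply]
  exact Finset.sum_eq_zero h

theorem eq_sum_zpow_smul_projection {t : Finset ℤ} (hmem : ∀ i m, π i m ∈ W i)
    (hsum : ∑ i ∈ t, π i = LinearMap.id) {L : V →ₗ[k] V} {c : k}
    (hL : ∀ i, ∀ m ∈ W i, L m = c ^ i • m) : L = ∑ i ∈ t, c ^ i • π i := by
  conv_lhs => rw [← LinearMap.comp_id L, ← hsum]
  ext m
  simp only [LinearMap.comp_apply, LinearMap.sum_apply, map_sum, LinearMap.smul_apply]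
  exact Finset.sum_congr rfl fun i _ ↦ hL i _ (hmem i m)

theorem projection_apply_of_weight {t : Finset ℤ} (hmem : ∀ i m, π i m ∈ W i)
    (hsame : ∀ i, ∀ m ∈ W i, π i m = m) (hne : ∀ i j, i ≠ j → ∀ m ∈ W j, π i m = 0)
    (hsum : ∑ i ∈ t, π i = LinearMap.id) {L : V →ₗ[k] V} {c : k}
    (hL : ∀ i, ∀ m ∈ W i, L m = c ^ i • m) {i : ℤ} (hi : i ∈ t) (m : V) :
    π i (L m) = c ^ i • π i m := by
  rw [eq_sum_zpow_smul_projection hmem hsum hL, LinearMap.sum_apply, map_sum,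
    Finset.sum_eq_single_of_mem i hi, LinearMap.smul_apply, map_smul, hsame i _ (hmem i m)]
  intro j _ hji
  rw [LinearMap.smul_apply, map_smul, hne i j hji.symm _ (hmem j m), smul_zero]

end Projections

section Conjugacy

variable {k : Type*} [Field k] {n : ℕ} {G : Subgroup (GL (Fin n) k)} {μ μ' : kˣ →* GL (Fin n) k}
  {W W' : ℤ → Submodule k (Fin n → k)}

theorem exists_conj_of_infinite [Infinite k]
    (hclosed : ∃ S : Set (MvPolynomial (Fin n × Fin n) k),
      ∀ g : GL (Fin n) k, g ∈ G ↔
        ∀ P ∈ S, MvPolynomial.eval (fun ij => (g : Matrix (Fin n) (Fin n) k) ij.1 ij.2) P = 0)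
    (hμG : ∀ z, μ z ∈ G) (hμ'G : ∀ z, μ' z ∈ G)
    (hWtop : ⨆ i, W i = ⊤) (hW'top : ⨆ i, W' i = ⊤) (hWind : iSupIndep W) (hW'ind : iSupIndep W')
    (hμact : ∀ (z : kˣ) (i : ℤ), ∀ m ∈ W i,
      ((μ z : GL (Fin n) k) : Matrix (Fin n) (Fin n) k).mulVecLin m = ((z : k) ^ i) • m)
    (hμ'act : ∀ (z : kˣ) (i : ℤ), ∀ m ∈ W' i,
      ((μ' z : GL (Fin n) k) : Matrix (Fin n) (Fin n) k).mulVecLin m = ((z : k) ^ i) • m)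
    (hfil : ∀ j : ℤ, weightFil W j = weightFil W' j) :
    ∃ g ∈ G, ∀ z : kˣ, μ' z = g * μ z * g⁻¹ := by
  obtain ⟨S, hS⟩ := hclosed
  obtain ⟨s, π, hmem, hsame, hne, hsum⟩ := exists_weight_projections hWind hWtop
  obtain ⟨s', π', hmem', hsame', hne', hsum'⟩ := exists_weight_projections hW'ind hW'top
  let t := s ∪ s'
  replace hsum := hsum t Finset.subset_union_left
  replace hsum' := hsum' t Finset.subset_union_right
  let A (i j : ℤ) : Matrix (Fin n) (Fin n) k := LinearMap.toMatrix' (π' i ∘ₗ π j)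
  have hA (i j : ℤ) (hij : i < j) : A i j = 0 := by
    have : π' i ∘ₗ π j = 0 := LinearMap.ext fun m ↦
      projection_eq_zero_of_mem_weightFil hne' hij
        (hfil j ▸ weight_le_weightFil W le_rfl (hmem j m))
    simp [A, this]
  let u : (Fin n → k) →ₗ[k] (Fin n → k) := ∑ i ∈ t, π' i ∘ₗ π i
  have hu : Function.Injective u :=
    injective_sum_projection_comp hfil hmem hsame hne hsum hmem' hsame' hne'
  have hdet : (LinearMap.toMatrix' u).det ≠ 0 := by
    rw [LinearMap.det_toMatrix']
    exact (LinearMap.isUnit_iff_isUnit_det _).1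
      ((LinearMap.isUnit_iff_ker_eq_bot u).2 (LinearMap.ker_eq_bot.2 hu)) |>.ne_zero
  let g : GL (Fin n) k := Matrix.GeneralLinearGroup.mkOfDetNeZero _ hdet
  have hg : (g : Matrix (Fin n) (Fin n) k) = LinearMap.toMatrix' u := rfl
  refine ⟨g, (hS g).2 fun P hP ↦ ?_, fun z ↦ ?_⟩
  · let F (x : Fin n × Fin n) : Polynomial k :=
      ∑ i ∈ t, ∑ j ∈ t, Polynomial.monomial (i - j).toNat (A i j x.1 x.2)
    have hF0 (x) : (F x).eval 0 = (g : Matrix (Fin n) (Fin n) k) x.1 x.2 := by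
      simp only [F, Polynomial.eval_finsetSum, Polynomial.eval_monomial, hg, u, map_sum,
        Matrix.sum_apply]
      refine Finset.sum_congr rfl fun i hi ↦ ?_
      rw [Finset.sum_eq_single_of_mem i hi]
      · simp [A]
      · intro j _ hji
        rcases hji.lt_or_gt with h | h
        · rw [zero_pow (by omega), mul_zero]
        · simp [hA i j h]
    have hFz (z : kˣ) (x) : (F x).eval (z : k) =
        ((μ' z * μ z⁻¹ : GL (Fin n) k) : Matrix (Fin n) (Fin n) k) x.1 x.2 := by
      have h : ((μ' z * μ z⁻¹ : GL (Fin n) k) : Matrix (Fin n) (Fin n) k) =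
          ∑ i ∈ t, ∑ j ∈ t, ((z : k) ^ (i - j)) • A i j := by
        have h₁ := eq_sum_zpow_smul_projection hmem hsum (hμact z⁻¹)
        have h₂ := eq_sum_zpow_smul_projection hmem' hsum' (hμ'act z)
        rw [← LinearMap.toMatrix'_toLin' (Units.val (μ' z * μ z⁻¹)),
          Matrix.toLin'_apply', Units.val_mul, Matrix.mulVecLin_mul, h₁, h₂,
          ← Module.End.mul_eq_comp, Finset.sum_mul_sum]
        simp only [smul_mul_smul_comm, Module.End.mul_eq_comp, map_sum, map_smul, A]
        refine Finset.sum_congr rfl fun i _ ↦ Finset.sum_congr rfl fun j _ ↦ ?_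
        rw [zpow_sub₀ z.ne_zero, Units.val_inv_eq_inv_val, _root_.inv_zpow, div_eq_mul_inv]
      rw [h]
      simp only [F, Polynomial.eval_finsetSum, Polynomial.eval_monomial, Matrix.sum_apply,
        Matrix.smul_apply, smul_eq_mul]
      refine Finset.sum_congr rfl fun i _ ↦ Finset.sum_congr rfl fun j _ ↦ ?_
      rcases lt_or_ge i j with hij | hij
      · simp [hA i j hij]
      · rw [mul_comm, ← zpow_natCast, Int.toNat_of_nonneg (by omega)]
    have := MvPolynomial.eval_curve_zero_of_forall_ne F P fun z hz ↦ by
      have := (hS _).1 (G.mul_mem (hμ'G (Units.mk0 z hz)) (hμG (Units.mk0 z hz)⁻¹)) P hP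
      simpa only [← hFz, Units.val_mk0] using this
    simpa only [hF0] using this
  · rw [eq_mul_inv_iff_mul_eq]
    refine Units.ext (Matrix.toLin'.injective (LinearMap.ext fun m ↦ ?_))
    have hgu : (g : Matrix (Fin n) (Fin n) k).mulVecLin = u := by
      rw [hg, ← Matrix.toLin'_apply', Matrix.toLin'_toMatrix']
    rw [Matrix.toLin'_apply', Matrix.toLin'_apply', Units.val_mul, Units.val_mul,
      Matrix.mulVecLin_mul, Matrix.mulVecLin_mul, hgu]
    simp only [LinearMap.comp_apply, u, LinearMap.sum_apply, map_sum]
    refine Finset.sum_congr rfl fun i hi ↦ ?_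
    rw [hμ'act z i _ (hmem' i _), projection_apply_of_weight hmem hsame hne hsum (hμact z) hi,
      map_smul]

/-- The invertible matrices acting trivially on the graded pieces of the filtration of `W`. -/
def weightUnipotent (W : ℤ → Submodule k (Fin n → k)) : Subgroup (GL (Fin n) k) where
  carrier := {g | ∀ j, ∀ m ∈ weightFil W j,
    (g : Matrix (Fin n) (Fin n) k) *ᵥ m - m ∈ weightFil W (j + 1) ∧
    ((g⁻¹ : GL (Fin n) k) : Matrix (Fin n) (Fin n) k) *ᵥ m - m ∈ weightFil W (j + 1)}
  one_mem' := by simp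
  inv_mem' h j m hm := by simpa using (h j m hm).symm
  mul_mem' {a b} ha hb j m hm := by
    have key (x y : Matrix (Fin n) (Fin n) k)
        (hx : ∀ j, ∀ m ∈ weightFil W j, x *ᵥ m - m ∈ weightFil W (j + 1))
        (hy : ∀ j, ∀ m ∈ weightFil W j, y *ᵥ m - m ∈ weightFil W (j + 1)) :
        (x * y) *ᵥ m - m ∈ weightFil W (j + 1) := by
      have h₁ := hy j m hm
      have h₂ := weightFil_antitone W (Int.le_add_one le_rfl) (hx _ _ h₁)
      have := add_mem (add_mem h₂ h₁) (hx j m hm)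
      rw [Matrix.mulVec_sub, Matrix.mulVec_mulVec] at this
      simpa using this
    refine ⟨key a b (fun j m h ↦ (ha j m h).1) (fun j m h ↦ (hb j m h).1), ?_⟩
    rw [_root_.mul_inv_rev]
    exact key _ _ (fun j m h ↦ (hb j m h).2) (fun j m h ↦ (ha j m h).2)

theorem isPGroup_weightUnipotent {p : ℕ} [Fact p.Prime] [CharP k p] (hWtop : ⨆ i, W i = ⊤)
    (hWind : iSupIndep W) : IsPGroup p (weightUnipotent W) := by
  rintro ⟨g, hg⟩
  have hnil : IsNilpotent ((g : Matrix (Fin n) (Fin n) k) - 1).mulVecLin :=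
    isNilpotent_of_mapsTo_weightFil hWind hWtop fun j m hm ↦ by
      simpa [Matrix.sub_mulVec] using (hg j m hm).1
  obtain ⟨N, hN⟩ := hnil
  rw [← Matrix.toLin'_apply', ← Matrix.toLin'_pow, LinearEquiv.map_eq_zero_iff] at hN
  obtain hn | hn := isEmpty_or_nonempty (Fin n)
  · exact ⟨0, Subsingleton.elim _ _⟩
  refine ⟨N, Subtype.ext (Units.ext ?_)⟩
  have hp : p.Prime := Fact.out
  have h := sub_pow_char_pow_of_commute (p := p) (n := N)
    (Commute.one_right (g : Matrix (Fin n) (Fin n) k))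
  rw [pow_eq_zero_of_le (Nat.lt_pow_self hp.one_lt).le hN, one_pow] at h
  simpa using (sub_eq_zero.1 h.symm)

theorem exists_conj_of_finite [Finite k]
    (hμG : ∀ z, μ z ∈ G) (hμ'G : ∀ z, μ' z ∈ G)
    (hWtop : ⨆ i, W i = ⊤) (hWind : iSupIndep W)
    (hμact : ∀ (z : kˣ) (i : ℤ), ∀ m ∈ W i,
      ((μ z : GL (Fin n) k) : Matrix (Fin n) (Fin n) k).mulVecLin m = ((z : k) ^ i) • m)
    (hμ'act : ∀ (z : kˣ) (i : ℤ), ∀ m ∈ W' i,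
      ((μ' z : GL (Fin n) k) : Matrix (Fin n) (Fin n) k).mulVecLin m = ((z : k) ^ i) • m)
    (hfil : ∀ j : ℤ, weightFil W j = weightFil W' j) :
    ∃ g ∈ G, ∀ z : kˣ, μ' z = g * μ z * g⁻¹ := by
  have := Fintype.ofFinite k
  obtain ⟨p, hchar⟩ := CharP.exists k
  have : Fact p.Prime := ⟨CharP.char_is_prime k p⟩
  let H := G ⊓ weightUnipotent W
  have hH : IsPGroup p H := (isPGroup_weightUnipotent hWtop hWind).to_le inf_le_right
  have hcop : (Nat.card kˣ).Coprime (Nat.card H) := by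
    obtain ⟨a, ha⟩ := IsPGroup.iff_card.1 hH
    rw [ha]
    refine Nat.Coprime.pow_right _ (Nat.Coprime.symm ((Nat.Prime.coprime_iff_not_dvd Fact.out).2
      fun h ↦ ?_))
    have h' : p ∣ Nat.card k := by
      rw [← CharP.cast_eq_zero_iff k p, Nat.card_eq_fintype_card, Nat.cast_card_eq_zero]
    rw [Nat.card_units] at h
    have := (Nat.dvd_sub_iff_right Finite.card_pos h').1 h
    exact (Fact.out : p.Prime).one_lt.ne' (Nat.dvd_one.1 this)
  obtain ⟨z₀, hz₀⟩ := IsCyclic.exists_generator (α := kˣ)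
  have hpow (ν : kˣ →* GL (Fin n) k) : ν z₀ ^ Nat.card kˣ = 1 := by
    rw [← map_pow, pow_card_eq_one', map_one]
  have act {z : kˣ} {j : ℤ} {m} (hm : m ∈ weightFil W j) :
      (μ z : Matrix (Fin n) (Fin n) k) *ᵥ m ∈ weightFil W j :=
    apply_mem_weightFil (hμact z) hm
  have hnorm (h : GL (Fin n) k) (hh : h ∈ H) : (μ z₀)⁻¹ * h * μ z₀ ∈ H := by
    refine ⟨G.mul_mem (G.mul_mem (G.inv_mem (hμG _)) hh.1) (hμG _), fun j m hm ↦ ?_⟩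
    have key (x : GL (Fin n) k)
        (hx : ∀ j, ∀ m ∈ weightFil W j,
          (x : Matrix (Fin n) (Fin n) k) *ᵥ m - m ∈ weightFil W (j + 1)) :
        (((μ z₀)⁻¹ * x * μ z₀ : GL (Fin n) k) : Matrix (Fin n) (Fin n) k) *ᵥ m - m
          ∈ weightFil W (j + 1) := by
      have := act (z := z₀⁻¹) (hx j _ (act (z := z₀) hm))
      rw [Matrix.mulVec_sub, Matrix.mulVec_mulVec, Matrix.mulVec_mulVec, Matrix.mulVec_mulVec,
        ← Units.val_mul, ← Units.val_mul, ← Units.val_mul, ← map_mul, inv_mul_cancel, map_one,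
        map_inv] at this
      simpa [mul_assoc] using this
    refine ⟨key h fun j m hm ↦ (hh.2 j m hm).1, ?_⟩
    rw [show ((μ z₀)⁻¹ * h * μ z₀)⁻¹ = (μ z₀)⁻¹ * h⁻¹ * μ z₀ by group]
    exact key _ fun j m hm ↦ (hh.2 j m hm).2
  have hst : (μ z₀)⁻¹ * μ' z₀ ∈ H := by
    refine ⟨G.mul_mem (G.inv_mem (hμG _)) (hμ'G _), fun j m hm ↦ ?_⟩
    have key {ν ν' : kˣ →* GL (Fin n) k} {Y Y' : ℤ → Submodule k (Fin n → k)}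
        (hν : ∀ (z : kˣ) (i : ℤ), ∀ m ∈ Y i,
          (ν z : Matrix (Fin n) (Fin n) k).mulVecLin m = ((z : k) ^ i) • m)
        (hν' : ∀ (z : kˣ) (i : ℤ), ∀ m ∈ Y' i,
          (ν' z : Matrix (Fin n) (Fin n) k).mulVecLin m = ((z : k) ^ i) • m)
        (hY : ∀ j, weightFil Y j = weightFil W j) (hY' : ∀ j, weightFil Y' j = weightFil W j) :
        (((ν z₀)⁻¹ * ν' z₀ : GL (Fin n) k) : Matrix (Fin n) (Fin n) k) *ᵥ m - m
          ∈ weightFil W (j + 1) := by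
      have h₁ := sub_smul_mem_weightFil (hν z₀) ((hY j).symm ▸ hm)
      have h₂ := sub_smul_mem_weightFil (hν' z₀) ((hY' j).symm ▸ hm)
      rw [hY] at h₁
      rw [hY'] at h₂
      have h₃ := sub_mem h₂ h₁
      rw [sub_sub_sub_cancel_right, ← hY] at h₃
      have h₄ := apply_mem_weightFil (hν z₀⁻¹) h₃
      rw [hY] at h₄
      simp only [Matrix.mulVecLin_apply] at h₄
      rw [Matrix.mulVec_sub, Matrix.mulVec_mulVec, Matrix.mulVec_mulVec,
        ← Units.val_mul, ← Units.val_mul, ← map_mul, inv_mul_cancel, map_one, map_inv] at h₄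
      simpa using h₄
    refine ⟨key hμact hμ'act (fun _ ↦ rfl) (fun j ↦ (hfil j).symm), ?_⟩
    rw [_root_.mul_inv_rev, inv_inv]
    exact key hμ'act hμact (fun j ↦ (hfil j).symm) (fun _ ↦ rfl)
  obtain ⟨h, hh, heq⟩ := exists_conj_eq_of_coprime H hcop (hpow μ) (hpow μ') hnorm hst
  refine ⟨h, hh.1, fun z ↦ ?_⟩
  obtain ⟨a, rfl⟩ := Subgroup.mem_zpowers_iff.1 (hz₀ z)
  rw [map_zpow, map_zpow, heq, conj_zpow]

end Conjugacy

theorem cocharacters_with_same_filtration_conjugate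
    (k : Type*) [Field k] (n : ℕ)
    (G : Subgroup (GL (Fin n) k))
    -- G is Zariski-closed in GL_n
    (hclosed : ∃ S : Set (MvPolynomial (Fin n × Fin n) k),
      ∀ g : GL (Fin n) k, g ∈ G ↔
        ∀ P ∈ S, MvPolynomial.eval (fun ij => (g : Matrix (Fin n) (Fin n) k) ij.1 ij.2) P = 0)
    -- G is reductive: no nontrivial normal unipotent subgroup
    (hred : ∀ N : Subgroup (GL (Fin n) k), N ≤ G →
      (∀ g ∈ G, ∀ x ∈ N, g * x * g⁻¹ ∈ N) →
      (∀ x ∈ N, IsNilpotent ((x : Matrix (Fin n) (Fin n) k) - 1)) → N = ⊥)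
    -- the cocharacters μ, μ' : 𝔾_m → G, with their weight gradings
    (μ μ' : kˣ →* GL (Fin n) k)
    (hμG : ∀ z, μ z ∈ G) (hμ'G : ∀ z, μ' z ∈ G)
    (W W' : ℤ → Submodule k (Fin n → k))
    (hWtop : ⨆ i, W i = ⊤) (hW'top : ⨆ i, W' i = ⊤)
    (hWindep : ∀ i, W i ⊓ (⨆ j ∈ {j : ℤ | j ≠ i}, W j) = ⊥)
    (hW'indep : ∀ i, W' i ⊓ (⨆ j ∈ {j : ℤ | j ≠ i}, W' j) = ⊥)
    (hμact : ∀ (z : kˣ) (i : ℤ), ∀ m ∈ W i,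
      ((μ z : GL (Fin n) k) : Matrix (Fin n) (Fin n) k).mulVec m = ((z : k) ^ i) • m)
    (hμ'act : ∀ (z : kˣ) (i : ℤ), ∀ m ∈ W' i,
      ((μ' z : GL (Fin n) k) : Matrix (Fin n) (Fin n) k).mulVec m = ((z : k) ^ i) • m)
    -- μ and μ' induce the same filtration on M
    (hfil : ∀ j : ℤ, (⨆ i ∈ {i : ℤ | j ≤ i}, W i) = ⨆ i ∈ {i : ℤ | j ≤ i}, W' i) :
    -- then μ and μ' are conjugate under G(k)
    ∃ g ∈ G, ∀ z : kˣ, μ' z = g * μ z * g⁻¹ := by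
  have hWind := iSupIndep_of_inf_eq_bot hWindep
  have hW'ind := iSupIndep_of_inf_eq_bot hW'indep
  cases finite_or_infinite k
  · exact exists_conj_of_finite hμG hμ'G hWtop hWind hμact hμ'act hfil
  · exact exists_conj_of_infinite hclosed hμG hμ'G hWtop hW'top hWind hW'ind hμact hμ'act hfil
end

section
/- Let F be a CM field with maximal totally real subfield F₀, and let V be an irreducible polarizable rational Hodge structure of K3 type with End_Hdg(V) = E and dim_E V = 1. Then the Mumford–Tate group of V equals the torus ker(Nm : Res_{E/Q} G_m → Res_{F/Q} G_m), where F is the maximal totally real subfield of E and Nm the norm map; in particular MT(V) is commutative. -/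
/-!
STATEMENT 15: Let `V` be an irreducible polarizable rational Hodge structure of K3 type
with `E = End_Hdg(V)` a CM field and `dim_E V = 1`.  Then the Mumford–Tate group of `V`
equals the torus `ker(Nm : Res_{E/ℚ} 𝔾_m → Res_{F/ℚ} 𝔾_m)` (`F` the maximal totally real
subfield of `E`); in particular `MT(V)` is commutative.

Model: `V = ℚⁿ`; the Hodge structure is the action `h : ℂˣ →* GL_n(ℂ)` of the real
points of the Deligne torus (real matrices), with its Hodge decomposition `H^{p,q}`
(weight 0, `dim H^{-1,1} = 1`, concentrated in `{(-1,1),(0,0),(1,-1)}`), polarizable and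
irreducible; `E` is the commutant of `h` in `M_n(ℚ)`, a field, with CM structure recorded
by the involution `ρ` (complex conjugation: intertwined with `conj` by every complex
embedding), and `F = E^ρ`, so that `Nm_{E/F}(u) = u·ρ(u)`.  The Mumford–Tate group at
rational points is the intersection of all subgroups of `GL_n` cut out by rational
polynomial equations whose complex solution set is a subgroup containing the image of
`h`; the conclusion identifies it with `{u ∈ Eˣ : u·ρ(u) = 1}` and asserts commutativity.
-/

open Matrix

variable (n : ℕ)

/-- The solution set condition for a family of rational polynomials, over a `ℚ`-algebra. -/
def polyZero (S : Set (MvPolynomial (Fin n × Fin n) ℚ)) (A : Type*) [CommRing A]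
    [Algebra ℚ A] (g : Matrix (Fin n) (Fin n) A) : Prop :=
  ∀ P ∈ S, MvPolynomial.aeval (fun ij : Fin n × Fin n => g ij.1 ij.2) P = 0

/-- `S` cuts out a `ℚ`-algebraic subgroup of `GL_n` whose complex points contain the
image of `h`. -/
def cutsOutGroupContaining (h : ℂˣ →* GL (Fin n) ℂ)
    (S : Set (MvPolynomial (Fin n × Fin n) ℚ)) : Prop :=
  polyZero n S ℂ (1 : Matrix (Fin n) (Fin n) ℂ) ∧
  (∀ g g' : GL (Fin n) ℂ, polyZero n S ℂ g.val → polyZero n S ℂ g'.val →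
    polyZero n S ℂ (g * g').val) ∧
  (∀ g : GL (Fin n) ℂ, polyZero n S ℂ g.val → polyZero n S ℂ (g⁻¹).val) ∧
  (∀ z : ℂˣ, polyZero n S ℂ (h z).val)

/-- The rational points of the Mumford–Tate group of the Hodge structure `h`. -/
def MTQ (h : ℂˣ →* GL (Fin n) ℂ) : Set (GL (Fin n) ℚ) :=
  {g | ∀ S : Set (MvPolynomial (Fin n × Fin n) ℚ), cutsOutGroupContaining n h S →
    polyZero n S ℚ g.val}

section Generator

variable {n} {K : Type*} [Field K] [Algebra ℚ K] (a : Module.Basis (Fin n) ℚ K)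
  (ι : K →ₐ[ℚ] Matrix (Fin n) (Fin n) ℚ) (v : Fin n → ℚ)

lemma mulVec_basis (ha : ∀ x i, a.repr x i = (ι x *ᵥ v) i)
    (j : Fin n) : ι (a j) *ᵥ v = Pi.single j 1 := by
  ext i
  rw [← ha, a.repr_self, Finsupp.single_eq_pi_single]

lemma eq_sum_mulVec_smul (ha : ∀ x i, a.repr x i = (ι x *ᵥ v) i)
    (x : K) : x = ∑ k, (ι x *ᵥ v) k • a k := by
  conv_lhs => rw [← a.sum_repr x]
  simp only [ha]

lemma mul_basis_eq_sum (ha : ∀ x i, a.repr x i = (ι x *ᵥ v) i)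
    (x : K) (j : Fin n) : x * a j = ∑ i, ι x i j • a i := by
  rw [eq_sum_mulVec_smul a ι v ha (x * a j)]
  simp [← Matrix.mulVec_mulVec, mulVec_basis a ι v ha]

/-- A matrix commuting with `K` is determined by its value on a `K`-generator. -/
lemma eq_sum_of_commute (ha : ∀ x i, a.repr x i = (ι x *ᵥ v) i)
    {R : Type*} [CommRing R] [Algebra ℚ R] (g : Matrix (Fin n) (Fin n) R)
    (hg : ∀ x, (ι x).map (algebraMap ℚ R) * g = g * (ι x).map (algebraMap ℚ R)) :
    g = ∑ k, (g *ᵥ (algebraMap ℚ R ∘ v)) k • (ι (a k)).map (algebraMap ℚ R) := by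
  have hbasis : ∀ j, (ι (a j)).map (algebraMap ℚ R) *ᵥ (algebraMap ℚ R ∘ v) =
      Pi.single j 1 := by
    intro j
    ext i
    rw [← RingHom.map_mulVec, mulVec_basis a ι v ha]
    rcases eq_or_ne i j with rfl | hij <;> simp [*]
  set y := g *ᵥ (algebraMap ℚ R ∘ v) with hy
  set s := ∑ k, y k • (ι (a k)).map (algebraMap ℚ R) with hs
  have hscomm : ∀ x, (ι x).map (algebraMap ℚ R) * s = s * (ι x).map (algebraMap ℚ R) := by
    intro x
    simp only [hs, Finset.mul_sum, Finset.sum_mul, Matrix.mul_smul, Matrix.smul_mul,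
      ← Matrix.map_mul, ← map_mul, mul_comm x]
  have hsv : s *ᵥ (algebraMap ℚ R ∘ v) = y := by
    rw [hs, Matrix.sum_mulVec]
    simp only [Matrix.smul_mulVec, hbasis]
    ext i
    simp [Pi.single_apply]
  have hcol : ∀ j, g *ᵥ Pi.single j 1 = s *ᵥ Pi.single j 1 := by
    intro j
    rw [← hbasis j, Matrix.mulVec_mulVec, Matrix.mulVec_mulVec, ← hg, ← hscomm,
      ← Matrix.mulVec_mulVec, ← Matrix.mulVec_mulVec, hsv]
  ext i j
  simpa using congrFun (hcol j) i

end Generator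

section Torus

variable {n} {K : Type*} [Field K] [Algebra ℚ K] [FiniteDimensional ℚ K]
  (a : Module.Basis (Fin n) ℚ K)

/-- The values of all complex embeddings on a rational basis of a number field. -/
noncomputable def embMatrix : Matrix (K →ₐ[ℚ] ℂ) (Fin n) ℂ :=
  Matrix.of fun φ j => φ (a j)

/-- The values of all complex embeddings on the trace-dual basis; inverse to `embMatrix`. -/
noncomputable def dualEmbMatrix : Matrix (Fin n) (K →ₐ[ℚ] ℂ) ℂ :=
  Matrix.of fun j φ => φ (a.traceDual j)

open Classical in
/-- The matrix which is diagonal with entries `c φ` in the simultaneous eigenbasis of `K`. -/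
noncomputable def torusMatrix (c : (K →ₐ[ℚ] ℂ) → ℂ) : Matrix (Fin n) (Fin n) ℂ :=
  dualEmbMatrix a * Matrix.diagonal c * embMatrix a

lemma dualEmbMatrix_mul_embMatrix : dualEmbMatrix a * embMatrix a = 1 := by
  ext i j
  simp only [Matrix.mul_apply, dualEmbMatrix, embMatrix, Matrix.of_apply, ← map_mul]
  rw [← trace_eq_sum_embeddings ℂ (K := ℚ) (L := K), a.trace_traceDual_mul]
  simp [Matrix.one_apply, eq_comm, apply_ite]

open Classical in
lemma embMatrix_mul_dualEmbMatrix : embMatrix a * dualEmbMatrix a = 1 := by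
  have hcard : Fintype.card (K →ₐ[ℚ] ℂ) = Fintype.card (Fin n) := by
    rw [AlgHom.card, Module.finrank_eq_card_basis a]
  exact (Matrix.mul_eq_one_comm_of_equiv (Fintype.equivOfCardEq hcard)).2
    (dualEmbMatrix_mul_embMatrix a)

lemma torusMatrix_mul (c d : (K →ₐ[ℚ] ℂ) → ℂ) :
    torusMatrix a (c * d) = torusMatrix a c * torusMatrix a d := by
  classical
  have h := embMatrix_mul_dualEmbMatrix a
  calc torusMatrix a (c * d)
      = dualEmbMatrix a * (Matrix.diagonal c * 1 * Matrix.diagonal d) * embMatrix a := by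
        simp [torusMatrix, Pi.mul_def]
    _ = _ := by rw [← h]; simp only [torusMatrix, Matrix.mul_assoc]

lemma torusMatrix_one : torusMatrix a 1 = 1 := by
  classical
  simp [torusMatrix, dualEmbMatrix_mul_embMatrix]

lemma torusMatrix_injective : Function.Injective (torusMatrix a) := by
  classical
  have h := embMatrix_mul_dualEmbMatrix a
  have key : ∀ c, embMatrix a * torusMatrix a c * dualEmbMatrix a = Matrix.diagonal c := by
    intro c
    calc _ = (embMatrix a * dualEmbMatrix a) * Matrix.diagonal c *
          (embMatrix a * dualEmbMatrix a) := by simp only [torusMatrix, Matrix.mul_assoc]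
      _ = _ := by simp [h]
  intro c d hcd
  exact Matrix.diagonal_injective (by rw [← key c, ← key d, hcd])

lemma torusMatrix_apply (c : (K →ₐ[ℚ] ℂ) → ℂ) (i j : Fin n) :
    torusMatrix a c i j = ∑ φ, φ (a.traceDual i) * c φ * φ (a j) := by
  classical
  simp [torusMatrix, Matrix.mul_apply, dualEmbMatrix, embMatrix, Matrix.diagonal_apply]

lemma torusMatrix_sum {κ : Type*} (s : Finset κ) (y : κ → ℂ) (c : κ → (K →ₐ[ℚ] ℂ) → ℂ) :
    ∑ k ∈ s, y k • torusMatrix a (c k) = torusMatrix a fun φ => ∑ k ∈ s, y k * c k φ := by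
  ext i j
  simp only [Matrix.sum_apply, Matrix.smul_apply, torusMatrix_apply, smul_eq_mul,
    Finset.mul_sum, Finset.sum_mul]
  rw [Finset.sum_comm]
  exact Finset.sum_congr rfl fun φ _ => Finset.sum_congr rfl fun k _ => by ring

/-- The diagonal torus in the simultaneous eigenbasis of `K`. -/
noncomputable def torusHom : ((K →ₐ[ℚ] ℂ) → ℂˣ) →* GL (Fin n) ℂ :=
  MonoidHom.toHomUnits
    { toFun := fun c => torusMatrix a fun φ => c φ
      map_one' := torusMatrix_one a
      map_mul' := fun c d => torusMatrix_mul a (fun φ => c φ) (fun φ => d φ) }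

lemma torusHom_val (c : (K →ₐ[ℚ] ℂ) → ℂˣ) :
    (torusHom a c).val = torusMatrix a fun φ => (c φ : ℂ) := rfl

variable (ι : K →ₐ[ℚ] Matrix (Fin n) (Fin n) ℚ) (v : Fin n → ℚ)

lemma map_eq_torusMatrix (ha : ∀ x i, a.repr x i = (ι x *ᵥ v) i)
    (x : K) :
    (ι x).map (algebraMap ℚ ℂ) = torusMatrix a fun φ => φ x := by
  classical
  have h : embMatrix a * (ι x).map (algebraMap ℚ ℂ) =
      Matrix.diagonal (fun φ : K →ₐ[ℚ] ℂ => φ x) * embMatrix a := by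
    ext φ j
    rw [Matrix.diagonal_mul]
    simp only [embMatrix, Matrix.of_apply, Matrix.mul_apply, Matrix.map_apply]
    rw [← map_mul, mul_basis_eq_sum a ι v ha x j, map_sum]
    exact Finset.sum_congr rfl fun i _ => by rw [map_smul, Algebra.smul_def, mul_comm]
  rw [torusMatrix, Matrix.mul_assoc, ← h, ← Matrix.mul_assoc, dualEmbMatrix_mul_embMatrix,
    one_mul]

lemma eq_torusMatrix_of_commute (ha : ∀ x i, a.repr x i = (ι x *ᵥ v) i)
    (g : Matrix (Fin n) (Fin n) ℂ)
    (hg : ∀ x, (ι x).map (algebraMap ℚ ℂ) * g = g * (ι x).map (algebraMap ℚ ℂ)) :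
    g = torusMatrix a fun φ => ∑ k, (g *ᵥ (algebraMap ℚ ℂ ∘ v)) k * φ (a k) := by
  rw [← torusMatrix_sum]
  simp only [← map_eq_torusMatrix a ι v ha]
  exact eq_sum_of_commute a ι v ha g hg

end Torus

section NormEquations

variable {n} {K : Type*} [Field K] [Algebra ℚ K] (a : Module.Basis (Fin n) ℚ K)
  (ι : K →ₐ[ℚ] Matrix (Fin n) (Fin n) ℚ) (v : Fin n → ℚ) (ρ : K ≃ₐ[ℚ] K)

/-- The commutator of a rational matrix with the generic matrix. -/
noncomputable def commutatorPoly (m : Matrix (Fin n) (Fin n) ℚ) :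
    Matrix (Fin n) (Fin n) (MvPolynomial (Fin n × Fin n) ℚ) :=
  m.map MvPolynomial.C * Matrix.mvPolynomialX (Fin n) (Fin n) ℚ -
    Matrix.mvPolynomialX (Fin n) (Fin n) ℚ * m.map MvPolynomial.C

/-- The polynomial form of `u * ρ u - 1`, for `u` in `K` written through its value at `v`. -/
noncomputable def normPoly : Matrix (Fin n) (Fin n) (MvPolynomial (Fin n × Fin n) ℚ) :=
  Matrix.mvPolynomialX (Fin n) (Fin n) ℚ *
    ∑ k, (Matrix.mvPolynomialX (Fin n) (Fin n) ℚ *ᵥ (MvPolynomial.C ∘ v)) k •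
      (ι (ρ (a k))).map MvPolynomial.C - 1

/-- Equations of the kernel of the norm torus inside the matrices. -/
def normEquations : Set (MvPolynomial (Fin n × Fin n) ℚ) :=
  {P | (∃ x i j, P = commutatorPoly (ι x) i j) ∨ ∃ i j, P = normPoly a ι v ρ i j}

variable {R : Type*} [CommRing R] [Algebra ℚ R] (g : Matrix (Fin n) (Fin n) R)

lemma aeval_commutatorPoly (m : Matrix (Fin n) (Fin n) ℚ) (i j : Fin n) :
    MvPolynomial.aeval (fun ij : Fin n × Fin n => g ij.1 ij.2) (commutatorPoly m i j) =
      (m.map (algebraMap ℚ R) * g - g * m.map (algebraMap ℚ R)) i j := by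
  simp [commutatorPoly, Matrix.mul_apply]

lemma aeval_normPoly (i j : Fin n) :
    MvPolynomial.aeval (fun ij : Fin n × Fin n => g ij.1 ij.2) (normPoly a ι v ρ i j) =
      (g * ∑ k, (g *ᵥ (algebraMap ℚ R ∘ v)) k • (ι (ρ (a k))).map (algebraMap ℚ R) - 1) i j := by
  rcases eq_or_ne i j with rfl | hij <;>
    simp [normPoly, Matrix.mul_apply, Matrix.sum_apply, Matrix.mulVec, dotProduct, *]

lemma polyZero_normEquations_iff :
    polyZero n (normEquations a ι v ρ) R g ↔
      (∀ x, (ι x).map (algebraMap ℚ R) * g = g * (ι x).map (algebraMap ℚ R)) ∧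
      g * ∑ k, (g *ᵥ (algebraMap ℚ R ∘ v)) k • (ι (ρ (a k))).map (algebraMap ℚ R) = 1 := by
  constructor
  · refine fun hg => ⟨fun x => sub_eq_zero.1 ?_, sub_eq_zero.1 ?_⟩
    · ext i j
      rw [← aeval_commutatorPoly]
      exact hg _ (Or.inl ⟨x, i, j, rfl⟩)
    · ext i j
      rw [← aeval_normPoly]
      exact hg _ (Or.inr ⟨i, j, rfl⟩)
  · rintro ⟨h₁, h₂⟩ P (⟨x, i, j, rfl⟩ | ⟨i, j, rfl⟩)
    · rw [aeval_commutatorPoly, h₁, sub_self, Matrix.zero_apply]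
    · rw [aeval_normPoly, h₂, sub_self, Matrix.zero_apply]

lemma polyZero_complex_normEquations_iff [FiniteDimensional ℚ K]
    (ha : ∀ x i, a.repr x i = (ι x *ᵥ v) i) (g : Matrix (Fin n) (Fin n) ℂ) :
    polyZero n (normEquations a ι v ρ) ℂ g ↔
      ∃ c : (K →ₐ[ℚ] ℂ) → ℂ, (∀ φ, c φ * c (φ.comp ρ) = 1) ∧ g = torusMatrix a c := by
  rw [polyZero_normEquations_iff]
  set c : (K →ₐ[ℚ] ℂ) → ℂ := fun φ => ∑ k, (g *ᵥ (algebraMap ℚ ℂ ∘ v)) k * φ (a k) with hc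
  have hconj : ∑ k, (g *ᵥ (algebraMap ℚ ℂ ∘ v)) k • (ι (ρ (a k))).map (algebraMap ℚ ℂ) =
      torusMatrix a fun φ => c (φ.comp ρ) := by
    simp only [map_eq_torusMatrix a ι v ha, torusMatrix_sum, hc]
    rfl
  rw [hconj]
  constructor
  · rintro ⟨h₁, h₂⟩
    have hg : g = torusMatrix a c := eq_torusMatrix_of_commute a ι v ha g h₁
    refine ⟨c, fun φ => ?_, hg⟩
    rw [hg, ← torusMatrix_mul, ← torusMatrix_one a] at h₂
    exact congrFun (torusMatrix_injective a h₂) φ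
  · rintro ⟨d, hd, hg⟩
    have h₁ : ∀ x, (ι x).map (algebraMap ℚ ℂ) * g = g * (ι x).map (algebraMap ℚ ℂ) := by
      intro x
      rw [map_eq_torusMatrix a ι v ha, hg, ← torusMatrix_mul, ← torusMatrix_mul, mul_comm]
    have hcd : d = c :=
      torusMatrix_injective a (hg.symm.trans (eq_torusMatrix_of_commute a ι v ha g h₁))
    refine ⟨h₁, ?_⟩
    rw [← hcd, hg, ← torusMatrix_mul, ← torusMatrix_one a]
    exact congrArg _ (funext hd)

end NormEquations

section Conjugation

open Polynomial

variable {K : Type*} [Field K] [Algebra ℚ K] {κ : Type*}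

/-- Clearing denominators in a rational polynomial evaluated at Laurent polynomials over `K`. -/
lemma exists_polynomial_eval_eq (b c d : κ → K) (P : MvPolynomial κ ℚ) :
    ∃ (m : ℕ) (Q : K[X]), ∀ (φ : K →ₐ[ℚ] ℂ) (t : ℂ), t ≠ 0 →
      (Q.map (φ : K →+* ℂ)).eval t =
        t ^ m * MvPolynomial.aeval (fun i => φ (b i) + t * φ (c i) + t⁻¹ * φ (d i)) P := by
  induction P using MvPolynomial.induction_on with
  | C r =>
    refine ⟨0, C (algebraMap ℚ K r), fun φ t _ => ?_⟩
    simp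
  | add p q hp hq =>
    obtain ⟨m, Q, hQ⟩ := hp
    obtain ⟨l, R, hR⟩ := hq
    refine ⟨m + l, X ^ l * Q + X ^ m * R, fun φ t ht => ?_⟩
    simp only [Polynomial.map_add, Polynomial.map_mul, Polynomial.map_pow, map_X, eval_add,
      eval_mul, eval_pow, eval_X, hQ φ t ht, hR φ t ht, map_add]
    ring
  | mul_X p i hp =>
    obtain ⟨m, Q, hQ⟩ := hp
    refine ⟨m + 1, Q * (C (b i) * X + C (c i) * X ^ 2 + C (d i)), fun φ t ht => ?_⟩
    simp only [Polynomial.map_add, Polynomial.map_mul, Polynomial.map_pow, map_X, map_C, eval_add,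
      eval_mul, eval_pow, eval_X, eval_C, hQ φ t ht, map_mul, MvPolynomial.aeval_X,
      RingHom.coe_coe]
    generalize MvPolynomial.aeval (fun i => φ (b i) + t * φ (c i) + t⁻¹ * φ (d i)) p = A
    field_simp
    ring

/-- A rational equation valid on infinitely many points of a one-parameter family defined
over `K`, in one embedding, is valid on the whole family, in all embeddings. -/
lemma aeval_eq_zero_of_infinite (b c d : κ → K) (P : MvPolynomial κ ℚ) (φ₀ : K →ₐ[ℚ] ℂ)
    {s : Set ℂ} (hs : s.Infinite) (hs0 : ∀ t ∈ s, t ≠ 0)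
    (hP : ∀ t ∈ s,
      MvPolynomial.aeval (fun i => φ₀ (b i) + t * φ₀ (c i) + t⁻¹ * φ₀ (d i)) P = 0)
    (φ : K →ₐ[ℚ] ℂ) {t : ℂ} (ht : t ≠ 0) :
    MvPolynomial.aeval (fun i => φ (b i) + t * φ (c i) + t⁻¹ * φ (d i)) P = 0 := by
  obtain ⟨m, Q, hQ⟩ := exists_polynomial_eval_eq b c d P
  have hQ₀ : Q.map (φ₀ : K →+* ℂ) = 0 := by
    refine Polynomial.eq_zero_of_infinite_isRoot _ (hs.mono fun t ht => ?_)
    simp only [Set.mem_ofPred_eq, IsRoot.def]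
    rw [hQ φ₀ t (hs0 t ht), hP t ht, mul_zero]
  rw [Polynomial.map_eq_zero] at hQ₀
  have h := hQ φ t ht
  rw [hQ₀, Polynomial.map_zero, eval_zero] at h
  exact (mul_eq_zero.1 h.symm).resolve_left (pow_ne_zero _ ht)

lemma infinite_div_conj :
    {t : ℂ | ∃ z : ℂˣ, t = (z : ℂ) / starRingEnd ℂ z}.Infinite := by
  have hne : ∀ s : ℝ, (⟨1, s⟩ : ℂ) ≠ 0 := fun s hs => by
    simpa using congrArg Complex.re hs
  refine Set.infinite_of_injective_forall_mem
    (f := fun s : ℝ => (⟨1, s⟩ : ℂ) / starRingEnd ℂ ⟨1, s⟩) ?_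
    fun s => ⟨Units.mk0 _ (hne s), rfl⟩
  intro s s' h
  have hne' : ∀ s : ℝ, starRingEnd ℂ (⟨1, s⟩ : ℂ) ≠ 0 := fun s =>
    (_root_.map_ne_zero _).2 (hne s)
  have h₁ := congrArg Complex.im ((div_eq_div_iff (hne' s) (hne' s')).1 h)
  simp at h₁
  linarith

/-- Hilbert 90 for an involution. -/
lemma exists_mul_conj_eq (ρ : K ≃ₐ[ℚ] K) (hρ2 : ∀ x, ρ (ρ x) = x) (hρne : ∃ y, ρ y ≠ y)
    {u : K} (hu : u * ρ u = 1) : ∃ x : K, x ≠ 0 ∧ u * ρ x = x := by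
  by_cases h : 1 + u = 0
  · obtain ⟨y, hy⟩ := hρne
    refine ⟨y - ρ y, sub_ne_zero.2 hy.symm, ?_⟩
    rw [map_sub, hρ2, eq_neg_of_add_eq_zero_right h]
    ring
  · refine ⟨1 + u, h, ?_⟩
    rw [map_add, map_one, mul_add, hu]
    ring

end Conjugation

section Cocharacter

variable {n} {K : Type*} [Field K] [Algebra ℚ K] (ρ : K ≃ₐ[ℚ] K)

lemma comp_ne_self {ρ : K ≃ₐ[ℚ] K} (hρne : ∃ y, ρ y ≠ y) (φ : K →ₐ[ℚ] ℂ) :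
    φ.comp (ρ : K →ₐ[ℚ] K) ≠ φ := by
  obtain ⟨y, hy⟩ := hρne
  exact fun h => hy (φ.injective (DFunLike.congr_fun h y))

lemma comp_comp_self {ρ : K ≃ₐ[ℚ] K} (hρ2 : ∀ x, ρ (ρ x) = x) (φ : K →ₐ[ℚ] ℂ) :
    (φ.comp (ρ : K →ₐ[ℚ] K)).comp (ρ : K →ₐ[ℚ] K) = φ :=
  AlgHom.ext fun x => congrArg φ (hρ2 x)

open Classical in
/-- The cocharacter with weight `1` at `φ`, weight `-1` at its conjugate, and `0` elsewhere. -/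
noncomputable def normOneCochar (φ : K →ₐ[ℚ] ℂ) (t : ℂˣ) : (K →ₐ[ℚ] ℂ) → ℂˣ :=
  Pi.mulSingle φ t * Pi.mulSingle (φ.comp (ρ : K →ₐ[ℚ] K)) t⁻¹

open Classical in
lemma normOneCochar_apply {φ : K →ₐ[ℚ] ℂ} (hφ : φ.comp (ρ : K →ₐ[ℚ] K) ≠ φ) (t : ℂˣ)
    (ψ : K →ₐ[ℚ] ℂ) :
    (normOneCochar ρ φ t ψ : ℂ) = 1 + (if ψ = φ then (t : ℂ) - 1 else 0) +
      (if ψ = φ.comp (ρ : K →ₐ[ℚ] K) then (t : ℂ)⁻¹ - 1 else 0) := by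
  simp only [normOneCochar, Pi.mul_apply, Pi.mulSingle_apply]
  by_cases h₁ : ψ = φ
  · have h₂ : ψ ≠ φ.comp (ρ : K →ₐ[ℚ] K) := fun h => hφ (h.symm.trans h₁)
    simp [h₁, hφ.symm]
  · by_cases h₂ : ψ = φ.comp (ρ : K →ₐ[ℚ] K) <;> simp [h₁, h₂, hφ]

lemma torusMatrix_normOneCochar [FiniteDimensional ℚ K] (a : Module.Basis (Fin n) ℚ K)
    {φ : K →ₐ[ℚ] ℂ} (hφ : φ.comp (ρ : K →ₐ[ℚ] K) ≠ φ) (t : ℂˣ) (i j : Fin n) :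
    torusMatrix a (fun ψ => (normOneCochar ρ φ t ψ : ℂ)) i j =
      φ ((1 : Matrix (Fin n) (Fin n) K) i j - a.traceDual i * a j - ρ (a.traceDual i * a j)) +
      t * φ (a.traceDual i * a j) + (t : ℂ)⁻¹ * φ (ρ (a.traceDual i * a j)) := by
  classical
  have h₁ : ∑ ψ : K →ₐ[ℚ] ℂ, ψ (a.traceDual i) * ψ (a j) =
      φ ((1 : Matrix (Fin n) (Fin n) K) i j) := by
    have := congrFun (congrFun (dualEmbMatrix_mul_embMatrix a) i) j
    simp only [Matrix.mul_apply, dualEmbMatrix, embMatrix, Matrix.of_apply] at this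
    rw [this]
    rcases eq_or_ne i j with rfl | hij <;> simp [*]
  rw [torusMatrix_apply]
  simp only [normOneCochar_apply ρ hφ, mul_add, add_mul, mul_one, Finset.sum_add_distrib, h₁,
    mul_ite, ite_mul, mul_zero, zero_mul, Finset.sum_ite_eq', Finset.mem_univ, if_true]
  simp only [map_sub, map_mul, AlgHom.comp_apply, AlgEquiv.coe_toAlgHom]
  ring

lemma normOneCochar_mul_comp {ρ : K ≃ₐ[ℚ] K} (hρ2 : ∀ x, ρ (ρ x) = x) (φ : K →ₐ[ℚ] ℂ) (t : ℂˣ)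
    (ψ : K →ₐ[ℚ] ℂ) :
    normOneCochar ρ φ t ψ * normOneCochar ρ φ t (ψ.comp (ρ : K →ₐ[ℚ] K)) = 1 := by
  classical
  have h₁ : ψ.comp (ρ : K →ₐ[ℚ] K) = φ ↔ ψ = φ.comp (ρ : K →ₐ[ℚ] K) :=
    ⟨fun h => by rw [← h, comp_comp_self hρ2], fun h => by rw [h, comp_comp_self hρ2]⟩
  have h₂ : ψ.comp (ρ : K →ₐ[ℚ] K) = φ.comp (ρ : K →ₐ[ℚ] K) ↔ ψ = φ :=
    ⟨fun h => by rw [← comp_comp_self hρ2 ψ, h, comp_comp_self hρ2], fun h => by rw [h]⟩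
  simp only [normOneCochar, Pi.mul_apply, Pi.mulSingle_apply, h₁, h₂]
  split_ifs <;> simp

/-- The cocharacters `normOneCochar` generate the elements `φ ↦ φ x / φ (ρ x)`. -/
lemma prod_normOneCochar [FiniteDimensional ℚ K] {ρ : K ≃ₐ[ℚ] K} (hρ2 : ∀ x, ρ (ρ x) = x)
    (c : (K →ₐ[ℚ] ℂ) → ℂˣ) (ψ : K →ₐ[ℚ] ℂ) :
    (∏ φ, normOneCochar ρ φ (c φ)) ψ = c ψ * (c (ψ.comp (ρ : K →ₐ[ℚ] K)))⁻¹ := by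
  classical
  have h₁ : ∀ φ : K →ₐ[ℚ] ℂ, ψ = φ.comp (ρ : K →ₐ[ℚ] K) ↔ φ = ψ.comp (ρ : K →ₐ[ℚ] K) :=
    fun φ => ⟨fun h => by rw [h, comp_comp_self hρ2], fun h => by rw [h, comp_comp_self hρ2]⟩
  simp only [Finset.prod_apply, normOneCochar, Pi.mul_apply, Pi.mulSingle_apply,
    Finset.prod_mul_distrib, h₁]
  simp

lemma embMatrix_mulVec_conj (a : Module.Basis (Fin n) ℚ K) {ρ : K ≃ₐ[ℚ] K}
    (hρCM : ∀ (φ : K →ₐ[ℚ] ℂ) (x : K), φ (ρ x) = starRingEnd ℂ (φ x))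
    (w : Fin n → ℂ) (φ : K →ₐ[ℚ] ℂ) :
    (embMatrix a *ᵥ fun i => starRingEnd ℂ (w i)) (φ.comp (ρ : K →ₐ[ℚ] K)) =
      starRingEnd ℂ ((embMatrix a *ᵥ w) φ) := by
  simp [Matrix.mulVec, dotProduct, embMatrix, hρCM]

end Cocharacter

section MumfordTate

variable {n} {K : Type*} [Field K] [Algebra ℚ K] [FiniteDimensional ℚ K]
  (a : Module.Basis (Fin n) ℚ K) (ι : K →ₐ[ℚ] Matrix (Fin n) (Fin n) ℚ) (v : Fin n → ℚ)
  {ρ : K ≃ₐ[ℚ] K}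

lemma polyZero_map_iff (S : Set (MvPolynomial (Fin n × Fin n) ℚ))
    (g : Matrix (Fin n) (Fin n) ℚ) :
    polyZero n S ℂ (g.map (algebraMap ℚ ℂ)) ↔ polyZero n S ℚ g := by
  refine forall₂_congr fun P _ => ?_
  have := MvPolynomial.aeval_algebraMap_apply ℂ (fun ij : Fin n × Fin n => g ij.1 ij.2) P
  exact (congrArg (· = 0) this).to_iff.trans (map_eq_zero _)

lemma cutsOutGroupContaining_normEquations (ha : ∀ x i, a.repr x i = (ι x *ᵥ v) i)
    (hρ2 : ∀ x, ρ (ρ x) = x) {h : ℂˣ →* GL (Fin n) ℂ} {φ₀ : K →ₐ[ℚ] ℂ}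
    (hh : ∀ z : ℂˣ, ∃ t : ℂˣ,
      (h z).val = torusMatrix a fun ψ => (normOneCochar ρ φ₀ t ψ : ℂ)) :
    cutsOutGroupContaining n h (normEquations a ι v ρ) := by
  simp only [cutsOutGroupContaining, polyZero_complex_normEquations_iff a ι v ρ ha]
  refine ⟨⟨1, by simp, (torusMatrix_one a).symm⟩, ?_, ?_, fun z => ?_⟩
  · rintro g g' ⟨c, hc, hg⟩ ⟨d, hd, hg'⟩
    refine ⟨c * d, fun φ => ?_, by rw [torusMatrix_mul, ← hg, ← hg']; rfl⟩
    simp only [Pi.mul_apply]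
    rw [mul_mul_mul_comm, hc, hd, one_mul]
  · rintro g ⟨c, hc, hg⟩
    refine ⟨c⁻¹, fun φ => by simp only [Pi.inv_apply]; rw [← mul_inv, hc, inv_one], ?_⟩
    have hmul : g.val * torusMatrix a c⁻¹ = 1 := by
      rw [hg, ← torusMatrix_mul, ← torusMatrix_one a]
      exact congrArg _ (funext fun φ => mul_inv_cancel₀ (left_ne_zero_of_mul_eq_one (hc φ)))
    rw [← mul_one (g⁻¹).val, ← hmul, ← mul_assoc, g.inv_mul, one_mul]
  · obtain ⟨t, ht⟩ := hh z
    exact ⟨_, fun φ => by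
      rw [← Units.val_mul, normOneCochar_mul_comp hρ2, Units.val_one], ht⟩

/-- A group of zeros of rational equations as a subgroup of `GL_n(ℂ)`. -/
def zeroSubgroup {h : ℂˣ →* GL (Fin n) ℂ} {S : Set (MvPolynomial (Fin n × Fin n) ℚ)}
    (hS : cutsOutGroupContaining n h S) : Subgroup (GL (Fin n) ℂ) where
  carrier := {g | polyZero n S ℂ g.val}
  one_mem' := hS.1
  mul_mem' := fun {g g'} hg hg' => hS.2.1 g g' hg hg'
  inv_mem' := fun {g} hg => hS.2.2.1 g hg

lemma torusHom_normOneCochar_mem (hρne : ∃ y, ρ y ≠ y) {h : ℂˣ →* GL (Fin n) ℂ}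
    {φ₀ : K →ₐ[ℚ] ℂ}
    (hh : ∀ z t : ℂˣ, (t : ℂ) = z / starRingEnd ℂ z →
      (h z).val = torusMatrix a fun ψ => (normOneCochar ρ φ₀ t ψ : ℂ))
    {S : Set (MvPolynomial (Fin n × Fin n) ℚ)} (hS : cutsOutGroupContaining n h S)
    (φ : K →ₐ[ℚ] ℂ) (t : ℂˣ) :
    torusHom a (normOneCochar ρ φ t) ∈ zeroSubgroup hS := by
  intro P hP
  simp only [torusHom_val, torusMatrix_normOneCochar ρ a (comp_ne_self hρne φ)]
  have hne : ∀ z : ℂˣ, (z : ℂ) / starRingEnd ℂ z ≠ 0 := fun z =>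
    div_ne_zero z.ne_zero ((map_ne_zero _).2 z.ne_zero)
  refine aeval_eq_zero_of_infinite
    (fun ij : Fin n × Fin n => (1 : Matrix (Fin n) (Fin n) K) ij.1 ij.2 -
      a.traceDual ij.1 * a ij.2 - ρ (a.traceDual ij.1 * a ij.2))
    (fun ij => a.traceDual ij.1 * a ij.2) (fun ij => ρ (a.traceDual ij.1 * a ij.2))
    P φ₀ infinite_div_conj ?_ ?_ φ t.ne_zero
  · rintro _ ⟨z, rfl⟩
    exact hne z
  · rintro _ ⟨z, rfl⟩
    have hz := hS.2.2.2 z P hP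
    rw [hh z (Units.mk0 _ (hne z)) rfl] at hz
    simpa only [torusMatrix_normOneCochar ρ a (comp_ne_self hρne φ₀), Units.val_mk0] using hz

theorem MTQ_eq_of_eq_normOneCochar (ha : ∀ x i, a.repr x i = (ι x *ᵥ v) i)
    (hρ2 : ∀ x, ρ (ρ x) = x) (hρne : ∃ y, ρ y ≠ y) {h : ℂˣ →* GL (Fin n) ℂ}
    {φ₀ : K →ₐ[ℚ] ℂ}
    (hh : ∀ z t : ℂˣ, (t : ℂ) = z / starRingEnd ℂ z →
      (h z).val = torusMatrix a fun ψ => (normOneCochar ρ φ₀ t ψ : ℂ)) :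
    MTQ n h = {g | ∃ u : K, ι u = g.val ∧ u * ρ u = 1} := by
  ext g
  constructor
  · intro hg
    have hg' := hg _ (cutsOutGroupContaining_normEquations a ι v ha hρ2 fun z =>
      ⟨Units.mk0 _ (div_ne_zero z.ne_zero ((map_ne_zero (starRingEnd ℂ)).2 z.ne_zero)),
        hh z _ rfl⟩)
    rw [polyZero_normEquations_iff] at hg'
    obtain ⟨h₁, h₂⟩ := hg'
    have h₃ := eq_sum_of_commute a ι v ha g.val h₁
    simp only [Algebra.algebraMap_self, RingHom.coe_id, Function.id_comp, Matrix.map_id,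
      ← map_smul, ← map_sum] at h₂ h₃
    refine ⟨_, h₃.symm, ?_⟩
    refine a.repr.injective (Finsupp.ext fun i => ?_)
    rw [ha, ha, map_mul, ← h₃, h₂, map_one]
  · rintro ⟨u, hu, hu1⟩ S hS
    obtain ⟨x, hx, hux⟩ := exists_mul_conj_eq ρ hρ2 hρne hu1
    have hφx : ∀ φ : K →ₐ[ℚ] ℂ, φ x ≠ 0 := fun φ => (map_ne_zero φ).2 hx
    have hmem : torusHom a (∏ φ, normOneCochar ρ φ (Units.mk0 (φ x) (hφx φ))) ∈
        zeroSubgroup hS := by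
      refine Subgroup.mem_comap.1 (Subgroup.prod_mem _ fun φ _ => ?_)
      exact torusHom_normOneCochar_mem a hρne hh hS φ _
    have hval : (torusHom a (∏ φ, normOneCochar ρ φ (Units.mk0 (φ x) (hφx φ)))).val =
        g.val.map (algebraMap ℚ ℂ) := by
      rw [← hu, map_eq_torusMatrix a ι v ha, torusHom_val]
      congr 1
      funext φ
      rw [prod_normOneCochar hρ2]
      have h₁ : φ u * φ (ρ x) = φ x := by rw [← map_mul, hux]
      simp [← h₁]
    rw [← polyZero_map_iff, ← hval]
    exact hmem

end MumfordTate

section Hodge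

variable {n} {K : Type*} [Field K] [Algebra ℚ K] [FiniteDimensional ℚ K]
  (a : Module.Basis (Fin n) ℚ K)

lemma embMatrix_mulVec_torusMatrix (c : (K →ₐ[ℚ] ℂ) → ℂ) (w : Fin n → ℂ) :
    embMatrix a *ᵥ (torusMatrix a c *ᵥ w) = c * (embMatrix a *ᵥ w) := by
  classical
  rw [torusMatrix, Matrix.mulVec_mulVec, ← Matrix.mul_assoc, ← Matrix.mul_assoc,
    embMatrix_mul_dualEmbMatrix, one_mul, ← Matrix.mulVec_mulVec]
  ext φ
  rw [Matrix.mulVec_diagonal, Pi.mul_apply]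

lemma embMatrix_mulVec_injective : Function.Injective (embMatrix a).mulVec := fun w w' hw => by
  simpa [Matrix.mulVec_mulVec, dualEmbMatrix_mul_embMatrix] using
    congrArg (dualEmbMatrix a).mulVec hw

/-- A Hodge structure of K3 type acting through the torus of `K` acts through one of the
norm-one cocharacters. -/
theorem exists_eq_normOneCochar {ρ : K ≃ₐ[ℚ] K} (hρ2 : ∀ x, ρ (ρ x) = x)
    (hρne : ∃ y, ρ y ≠ y)
    (hρCM : ∀ (φ : K →ₐ[ℚ] ℂ) (x : K), φ (ρ x) = starRingEnd ℂ (φ x))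
    (h : ℂˣ →* GL (Fin n) ℂ) (hK : ∀ z, ∃ c, (h z).val = torusMatrix a c)
    (Hpq : ℤ × ℤ → Submodule ℂ (Fin n → ℂ))
    (hwt : ∀ p q : ℤ, p + q ≠ 0 → Hpq (p, q) = ⊥)
    (hK3a : ∀ p q : ℤ, 2 < |p - q| → Hpq (p, q) = ⊥)
    (hK3b : Module.finrank ℂ (Hpq (-1, 1)) = 1)
    (hsum : (⨆ pq : ℤ × ℤ, Hpq pq) = ⊤)
    (hconj : ∀ (p q : ℤ) (v : Fin n → ℂ), v ∈ Hpq (p, q) →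
      (fun i => starRingEnd ℂ (v i)) ∈ Hpq (q, p))
    (hact : ∀ (z : ℂˣ) (p q : ℤ), ∀ v ∈ Hpq (p, q),
      (h z).val.mulVec v = (((z : ℂ) ^ (-p)) * ((starRingEnd ℂ (z : ℂ)) ^ (-q))) • v) :
    ∃ φ₀ : K →ₐ[ℚ] ℂ, ∀ z t : ℂˣ, (t : ℂ) = z / starRingEnd ℂ z →
      (h z).val = torusMatrix a fun ψ => (normOneCochar ρ φ₀ t ψ : ℂ) := by
  classical
  choose χ hχ using hK
  have hchar : ∀ p q w φ, w ∈ Hpq (p, q) → (embMatrix a *ᵥ w) φ ≠ 0 → ∀ z : ℂˣ,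
      χ z φ = (z : ℂ) ^ (-p) * (starRingEnd ℂ (z : ℂ)) ^ (-q) := by
    intro p q w φ hw hne z
    have h₁ := congrArg (fun w => (embMatrix a *ᵥ w) φ) (hact z p q w hw)
    simp only [hχ, embMatrix_mulVec_torusMatrix, Matrix.mulVec_smul, Pi.mul_apply,
      Pi.smul_apply, smul_eq_mul] at h₁
    exact mul_right_cancel₀ hne h₁
  have hcases : ∀ p q : ℤ, (p, q) = (-1, 1) ∨ (p, q) = (0, 0) ∨ (p, q) = (1, -1) ∨
      Hpq (p, q) = ⊥ := by
    intro p q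
    by_cases h₁ : p + q = 0
    · by_cases h₂ : 2 < |p - q|
      · exact Or.inr (Or.inr (Or.inr (hK3a p q h₂)))
      · rw [not_lt, abs_le] at h₂
        simp only [Prod.mk.injEq]
        omega
    · exact Or.inr (Or.inr (Or.inr (hwt p q h₁)))
  have hsup : Hpq (-1, 1) ⊔ Hpq (0, 0) ⊔ Hpq (1, -1) = ⊤ := by
    rw [eq_top_iff, ← hsum, iSup_le_iff]
    rintro ⟨p, q⟩
    rcases hcases p q with h₁ | h₁ | h₁ | h₁ <;> rw [h₁]
    · exact le_sup_left.trans le_sup_left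
    · exact le_sup_right.trans le_sup_left
    · exact le_sup_right
    · exact bot_le
  obtain ⟨z₀, hz₀⟩ : ∃ z : ℂˣ, (z : ℂ) = 1 + Complex.I :=
    ⟨Units.mk0 (1 + Complex.I) fun h => by simpa using congrArg Complex.re h, rfl⟩
  have hz₀ne : starRingEnd ℂ (z₀ : ℂ) ≠ 0 := (map_ne_zero _).2 z₀.ne_zero
  have hz₀' : (z₀ : ℂ) = Complex.I * starRingEnd ℂ (z₀ : ℂ) := by
    rw [hz₀]
    simp [mul_add, add_comm]
  have hχI : ∀ w φ, w ∈ Hpq (-1, 1) → (embMatrix a *ᵥ w) φ ≠ 0 → χ z₀ φ = Complex.I := by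
    intro w φ hw hne
    rw [hchar _ _ w φ hw hne z₀]
    nth_rw 1 [hz₀']
    simp [hz₀ne]
  have hχ1 : ∀ w φ, w ∈ Hpq (0, 0) → (embMatrix a *ᵥ w) φ ≠ 0 → ∀ z, χ z φ = 1 := by
    intro w φ hw hne z
    simp [hchar _ _ w φ hw hne z]
  have hχnegI : ∀ w φ, w ∈ Hpq (1, -1) → (embMatrix a *ᵥ w) φ ≠ 0 →
      χ z₀ φ = -Complex.I := by
    intro w φ hw hne
    rw [hchar _ _ w φ hw hne z₀]
    nth_rw 1 [hz₀']
    field_simp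
    simp
  have hI1 : Complex.I ≠ 1 := fun h => by simpa using congrArg Complex.re h
  have hInegI : Complex.I ≠ -Complex.I := fun h => by
    have := congrArg Complex.im h
    norm_num at this
  -- the eigenline of an embedding of weight `(-1, 1)` lies in the Hodge piece
  have hline : ∀ w φ, w ∈ Hpq (-1, 1) → (embMatrix a *ᵥ w) φ ≠ 0 →
      ∃ r ∈ Hpq (-1, 1), embMatrix a *ᵥ r = Pi.single φ 1 := by
    intro w φ hw hne
    have hr : dualEmbMatrix a *ᵥ Pi.single φ 1 ∈ Hpq (-1, 1) ⊔ Hpq (0, 0) ⊔ Hpq (1, -1) :=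
      hsup ▸ Submodule.mem_top
    obtain ⟨xy, hxy, u, hu, hxyu⟩ := Submodule.mem_sup.1 hr
    obtain ⟨x, hx, y, hy, rfl⟩ := Submodule.mem_sup.1 hxy
    have hL : embMatrix a *ᵥ x + embMatrix a *ᵥ y + embMatrix a *ᵥ u = Pi.single φ 1 := by
      rw [← Matrix.mulVec_add, ← Matrix.mulVec_add, hxyu, Matrix.mulVec_mulVec,
        embMatrix_mul_dualEmbMatrix, Matrix.one_mulVec]
    refine ⟨x, hx, funext fun ψ => ?_⟩
    have hLψ := congrFun hL ψ
    simp only [Pi.add_apply] at hLψ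
    by_cases hψ : χ z₀ ψ = Complex.I
    · have hy0 : (embMatrix a *ᵥ y) ψ = 0 := by
        by_contra hne
        exact hI1 (hψ.symm.trans (hχ1 y ψ hy hne z₀))
      have hu0 : (embMatrix a *ᵥ u) ψ = 0 := by
        by_contra hne
        exact hInegI (hψ.symm.trans (hχnegI u ψ hu hne))
      simpa [hy0, hu0] using hLψ
    · have hx0 : (embMatrix a *ᵥ x) ψ = 0 := by
        by_contra hne
        exact hψ (hχI x ψ hx hne)
      have hψφ : ψ ≠ φ := by
        rintro rfl
        exact hψ (hχI w ψ hw hne)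
      rw [hx0, Pi.single_eq_of_ne hψφ]
  obtain ⟨⟨w₀, hw₀⟩, hw₀ne, hw₀span⟩ := finrank_eq_one_iff'.1 hK3b
  have hw₀0 : embMatrix a *ᵥ w₀ ≠ 0 := by
    intro h0
    refine hw₀ne (Subtype.ext (embMatrix_mulVec_injective a ?_))
    simpa using h0
  obtain ⟨φ₀, hφ₀⟩ := Function.ne_iff.1 hw₀0
  have hunique : ∀ w φ, w ∈ Hpq (-1, 1) → (embMatrix a *ᵥ w) φ ≠ 0 → φ = φ₀ := by
    intro w φ hw hne
    obtain ⟨r, hr, hrφ⟩ := hline w φ hw hne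
    obtain ⟨c, hc⟩ := hw₀span ⟨r, hr⟩
    have hc' : c • w₀ = r := congrArg Subtype.val hc
    rw [← hc', Matrix.mulVec_smul] at hrφ
    by_contra hφ
    have h₁ := congrFun hrφ φ
    have h₂ := congrFun hrφ φ₀
    rw [Pi.single_eq_of_ne (Ne.symm hφ)] at h₂
    simp only [Pi.smul_apply, smul_eq_mul, Pi.single_eq_same] at h₁ h₂
    rw [(mul_eq_zero.1 h₂).resolve_right hφ₀, zero_mul] at h₁
    exact zero_ne_one h₁
  refine ⟨φ₀, fun z t ht => ?_⟩
  rw [hχ]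
  congr 1
  funext ψ
  rw [normOneCochar_apply ρ (comp_ne_self hρne φ₀)]
  by_cases hψ : ψ = φ₀
  · rw [if_pos hψ, if_neg (hψ ▸ (comp_ne_self hρne ψ).symm), hψ,
      hchar _ _ w₀ φ₀ hw₀ hφ₀, ht]
    simp [div_eq_mul_inv]
  · rw [if_neg hψ]
    by_cases hψ' : ψ = φ₀.comp (ρ : K →ₐ[ℚ] K)
    · rw [if_pos hψ', hψ', hchar _ _ _ _ (hconj _ _ w₀ hw₀)
        (by rwa [embMatrix_mulVec_conj a hρCM, map_ne_zero]), ht]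
      simp [div_eq_mul_inv, mul_comm]
    · rw [if_neg hψ', add_zero, add_zero]
      have hr : dualEmbMatrix a *ᵥ Pi.single ψ 1 ∈ Hpq (-1, 1) ⊔ Hpq (0, 0) ⊔ Hpq (1, -1) :=
        hsup ▸ Submodule.mem_top
      obtain ⟨xy, hxy, u, hu, hxyu⟩ := Submodule.mem_sup.1 hr
      obtain ⟨x, hx, y, hy, rfl⟩ := Submodule.mem_sup.1 hxy
      have hL := congrArg (fun w => (embMatrix a *ᵥ w) ψ) hxyu
      simp only [Matrix.mulVec_add, Matrix.mulVec_mulVec, embMatrix_mul_dualEmbMatrix,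
        Matrix.one_mulVec, Pi.add_apply, Pi.single_eq_same] at hL
      have hx0 : (embMatrix a *ᵥ x) ψ = 0 := by
        by_contra hne
        exact hψ (hunique x ψ hx hne)
      have hu0 : (embMatrix a *ᵥ u) ψ = 0 := by
        by_contra hne
        refine hψ' ?_
        rw [← hunique _ (ψ.comp (ρ : K →ₐ[ℚ] K)) (hconj _ _ u hu)
          (by rwa [embMatrix_mulVec_conj a hρCM, map_ne_zero]), comp_comp_self hρ2]
      exact hχ1 y ψ hy (by rw [hx0, hu0, zero_add, add_zero] at hL; simp [hL]) z

end Hodge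

/-- The basis of `K` corresponding to the standard basis of `ℚⁿ` under `x ↦ x v`. -/
lemma exists_basis_repr_eq_mulVec {n : ℕ} {K : Type*} [Field K] [Algebra ℚ K]
    (ι : K →ₐ[ℚ] Matrix (Fin n) (Fin n) ℚ) {v : Fin n → ℚ} (hv : v ≠ 0)
    (hgen : ∀ w, ∃ x, ι x *ᵥ v = w) :
    ∃ a : Module.Basis (Fin n) ℚ K, ∀ x i, a.repr x i = (ι x *ᵥ v) i := by
  let f : K →ₗ[ℚ] (Fin n → ℚ) :=
    { toFun := fun x => ι x *ᵥ v
      map_add' := fun x y => by rw [map_add, Matrix.add_mulVec]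
      map_smul' := fun c x => by rw [map_smul, Matrix.smul_mulVec, RingHom.id_apply] }
  have hf : Function.Injective f := by
    rw [← LinearMap.ker_eq_bot, LinearMap.ker_eq_bot']
    intro x (hx : ι x *ᵥ v = 0)
    by_contra hx0
    apply hv
    calc v = ι (x⁻¹ * x) *ᵥ v := by rw [inv_mul_cancel₀ hx0, map_one, Matrix.one_mulVec]
      _ = 0 := by rw [map_mul, ← Matrix.mulVec_mulVec, hx, Matrix.mulVec_zero]
  exact ⟨Module.Basis.ofEquivFun (LinearEquiv.ofBijective f ⟨hf, hgen⟩), fun x i => rfl⟩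

theorem MT_of_K3_type_CM_is_kernel_of_norm
    -- the Hodge structure: an action of 𝕊(ℝ) = ℂˣ by real matrices …
    (h : ℂˣ →* GL (Fin n) ℂ)
    (hreal : ∀ (z : ℂˣ) (i j : Fin n), ∃ r : ℝ, (h z).val i j = (r : ℂ))
    -- … with Hodge decomposition of K3 type (weight 0, dim H^{-1,1} = 1)
    (Hpq : ℤ × ℤ → Submodule ℂ (Fin n → ℂ))
    (hwt : ∀ a b : ℤ, a + b ≠ 0 → Hpq (a, b) = ⊥)
    (hK3a : ∀ a b : ℤ, 2 < |a - b| → Hpq (a, b) = ⊥)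
    (hK3b : Module.finrank ℂ (Hpq (-1, 1)) = 1)
    (hsum : (⨆ ab : ℤ × ℤ, Hpq ab) = ⊤)
    (hconj : ∀ (a b : ℤ) (v : Fin n → ℂ), v ∈ Hpq (a, b) →
      (fun i => starRingEnd ℂ (v i)) ∈ Hpq (b, a))
    (hact : ∀ (z : ℂˣ) (a b : ℤ), ∀ v ∈ Hpq (a, b),
      (h z).val.mulVec v = (((z : ℂ) ^ (-a)) * ((starRingEnd ℂ (z : ℂ)) ^ (-b))) • v)
    -- polarizable
    (hpol : ∃ ψ : Matrix (Fin n) (Fin n) ℚ, ψ.IsSymm ∧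
      (∀ z : ℂˣ, (h z).valᵀ * ψ.map (fun q : ℚ => (q : ℂ)) * (h z).val =
        ψ.map (fun q : ℚ => (q : ℂ))) ∧
      (∀ (a b : ℤ) (v : Fin n → ℂ), v ∈ Hpq (a, b) → v ≠ 0 →
        0 < ((Complex.I ^ (a - b)) *
          (v ⬝ᵥ (ψ.map (fun q : ℚ => (q : ℂ))).mulVec (fun i => starRingEnd ℂ (v i)))).re))
    -- irreducible as a rational Hodge structure
    (hirr : ∀ W : Submodule ℚ (Fin n → ℚ),
      (∀ z : ℂˣ, ∀ w ∈ W, (h z).val.mulVec (fun i => ((w i : ℚ) : ℂ)) ∈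
        Submodule.span ℂ ((fun u : Fin n → ℚ => (fun i => ((u i : ℚ) : ℂ))) '' W)) →
      W = ⊥ ∨ W = ⊤)
    -- E = End_Hdg(V): the commutant of h in M_n(ℚ)
    (E : Subalgebra ℚ (Matrix (Fin n) (Fin n) ℚ))
    (hE : ∀ m : Matrix (Fin n) (Fin n) ℚ, m ∈ E ↔
      ∀ z : ℂˣ, (m.map (fun q : ℚ => (q : ℂ))) * (h z).val =
        (h z).val * (m.map (fun q : ℚ => (q : ℂ))))
    -- E is a CM field (with complex conjugation ρ, fixing the maximal totally real F)
    (hEfield : IsField E)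
    (ρ : E ≃ₐ[ℚ] E) (hρ2 : ρ.trans ρ = AlgEquiv.refl) (hρne : ρ ≠ AlgEquiv.refl)
    (hρCM : ∀ (φ : E →ₐ[ℚ] ℂ) (x : E), φ (ρ x) = starRingEnd ℂ (φ x))
    -- dim_E V = 1
    (hdim : ∀ v : Fin n → ℚ, v ≠ 0 → ∀ w : Fin n → ℚ, ∃ u ∈ E, u.mulVec v = w) :
    -- MT(V) = ker(Nm : Res_{E/ℚ} 𝔾_m → Res_{F/ℚ} 𝔾_m) = {u ∈ Eˣ : u · ρ(u) = 1} …
    (MTQ n h = {g : GL (Fin n) ℚ |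
      ∃ hu : g.val ∈ E, (⟨g.val, hu⟩ : E) * ρ ⟨g.val, hu⟩ = 1}) ∧
    -- … in particular MT(V) is commutative
    (∀ g ∈ MTQ n h, ∀ g' ∈ MTQ n h, g * g' = g' * g) := by
  let _ : Field E := hEfield.toField
  have hn : Nonempty (Fin n) := by
    by_contra hempty
    rw [not_nonempty_iff] at hempty
    rw [Module.finrank_zero_of_subsingleton] at hK3b
    exact zero_ne_one hK3b
  have hv : (fun _ => 1 : Fin n → ℚ) ≠ 0 := fun h0 => one_ne_zero (congrFun h0 hn.some)
  obtain ⟨a, ha⟩ := exists_basis_repr_eq_mulVec (K := E) E.val hv fun w => by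
    obtain ⟨u, hu, huw⟩ := hdim _ hv w
    exact ⟨⟨u, hu⟩, huw⟩
  have : FiniteDimensional ℚ E := Module.Finite.of_basis a
  have hρ2' : ∀ x, ρ (ρ x) = x := DFunLike.congr_fun hρ2
  have hρne' : ∃ y, ρ y ≠ y := by
    by_contra! hall
    exact hρne (AlgEquiv.ext hall)
  obtain ⟨φ₀, hφ₀⟩ := exists_eq_normOneCochar (K := E) a hρ2' hρne' hρCM h
    (fun z => ⟨_, eq_torusMatrix_of_commute a E.val _ ha _ fun x => (hE x).1 x.2 z⟩)
    Hpq hwt hK3a hK3b hsum hconj hact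
  have hMT : MTQ n h = {g : GL (Fin n) ℚ |
      ∃ hu : g.val ∈ E, (⟨g.val, hu⟩ : E) * ρ ⟨g.val, hu⟩ = 1} := by
    rw [MTQ_eq_of_eq_normOneCochar a E.val _ ha hρ2' hρne' hφ₀]
    ext g
    constructor
    · rintro ⟨⟨u, hu⟩, rfl, hu1⟩
      exact ⟨hu, hu1⟩
    · rintro ⟨hu, hu1⟩
      exact ⟨⟨g.val, hu⟩, rfl, hu1⟩
  refine ⟨hMT, fun g hg g' hg' => ?_⟩
  rw [hMT] at hg hg'
  exact Units.ext (congrArg Subtype.val (hEfield.mul_comm ⟨g.val, hg.1⟩ ⟨g'.val, hg'.1⟩))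
end
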